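/- arXiv:2311.11907 — 3 statements merged into one kernel-verified Lean document; each statement's English description precedes it below -/
import Mathlib

section
/- If φ : H₃(𝕆) → H₃(𝕆) is an ℝ-linear bijection satisfying φ(X∘Y) = φ(X)∘φ(Y) for all X, Y ∈ H₃(𝕆), then φ preserves the trace: Tr(φ(X)) = Tr(X) for all X ∈ H₃(𝕆). -/
/- Octonions via the Cayley–Dickson construction over the quaternions. -/

noncomputable section

open Quaternion

/-- The octonions, as pairs of quaternions. -/
abbrev Oct : Type := ℍ[ℝ] × ℍ[ℝ]

/-- Cayley–Dickson multiplication: (a,b)·(c,d) = (a·c − conj(d)·b, d·a + b·conj(c)). -/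
def omul (x y : Oct) : Oct :=
  ⟨x.1 * y.1 - star y.2 * x.2, y.2 * x.1 + x.2 * star y.1⟩

/-- Octonionic conjugation: conj(a,b) = (conj a, −b). -/
def oconj (x : Oct) : Oct := ⟨star x.1, -x.2⟩

/-- The octonionic unit. -/
def oone : Oct := ⟨1, 0⟩

/-- The octonionic norm: the sum of the squares of the eight real coordinates. -/
def onorm (x : Oct) : ℝ := Quaternion.normSq x.1 + Quaternion.normSq x.2

lemma omul_add_left (x x' y : Oct) : omul (x + x') y = omul x y + omul x' y := by
  simp only [omul, Prod.fst_add, Prod.snd_add, Prod.mk_add_mk, Prod.mk.injEq, add_mul, mul_add]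
  constructor <;> abel

lemma omul_add_right (x y y' : Oct) : omul x (y + y') = omul x y + omul x y' := by
  simp only [omul, Prod.fst_add, Prod.snd_add, Prod.mk_add_mk, Prod.mk.injEq, add_mul, mul_add,
    star_add]
  constructor <;> abel

lemma omul_smul_left (r : ℝ) (x y : Oct) : omul (r • x) y = r • omul x y := by
  simp [omul, Prod.ext_iff, smul_mul_assoc, mul_smul_comm, smul_sub, smul_add]

lemma omul_smul_right (r : ℝ) (x y : Oct) : omul x (r • y) = r • omul x y := by
  simp [omul, Prod.ext_iff, smul_mul_assoc, mul_smul_comm, smul_sub, smul_add, Quaternion.star_smul]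

lemma omul_zero_left (y : Oct) : omul 0 y = 0 := by
  simp [omul, Prod.ext_iff]

lemma omul_zero_right (x : Oct) : omul x 0 = 0 := by
  simp [omul, Prod.ext_iff]


lemma oconj_add (x y : Oct) : oconj (x + y) = oconj x + oconj y := by
  simp only [oconj, Prod.fst_add, Prod.snd_add, Prod.mk_add_mk, Prod.mk.injEq]
  exact ⟨star_add _ _, by abel⟩

lemma oconj_smul (r : ℝ) (x : Oct) : oconj (r • x) = r • oconj x := by
  simp [oconj, Prod.ext_iff, Quaternion.star_smul]

lemma oconj_sum {ι : Type*} (s : Finset ι) (f : ι → Oct) :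
    oconj (∑ i ∈ s, f i) = ∑ i ∈ s, oconj (f i) :=
  map_sum (AddMonoidHom.mk' oconj oconj_add) f s

lemma oconj_omul (x y : Oct) : oconj (omul x y) = omul (oconj y) (oconj x) := by
  simp only [oconj, omul, Prod.mk.injEq]
  constructor
  · simp [star_sub, star_mul, star_star, neg_mul_neg, star_neg]
  · simp only [star_star, neg_mul, mul_neg, neg_add, neg_neg]
    abel

/-- Octonionic conjugate-transpose of a 3×3 matrix. -/
def octConjT (A : Matrix (Fin 3) (Fin 3) Oct) : Matrix (Fin 3) (Fin 3) Oct :=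
  Matrix.of fun i j => oconj (A j i)

/-- Multiplication of 3×3 octonionic matrices. -/
def mmul (A B : Matrix (Fin 3) (Fin 3) Oct) : Matrix (Fin 3) (Fin 3) Oct :=
  Matrix.of fun i j => ∑ k : Fin 3, omul (A i k) (B k j)

lemma octConjT_add (A B : Matrix (Fin 3) (Fin 3) Oct) :
    octConjT (A + B) = octConjT A + octConjT B := by
  refine Matrix.ext fun i j => ?_
  simp [octConjT, oconj_add]

lemma octConjT_smul (r : ℝ) (A : Matrix (Fin 3) (Fin 3) Oct) :
    octConjT (r • A) = r • octConjT A := by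
  refine Matrix.ext fun i j => ?_
  simp [octConjT, oconj_smul]

lemma octConjT_mmul (A B : Matrix (Fin 3) (Fin 3) Oct) :
    octConjT (mmul A B) = mmul (octConjT B) (octConjT A) := by
  refine Matrix.ext fun i j => ?_
  simp [octConjT, mmul, oconj_sum, oconj_omul]

lemma mmul_add_left (A B C : Matrix (Fin 3) (Fin 3) Oct) :
    mmul (A + B) C = mmul A C + mmul B C := by
  refine Matrix.ext fun i j => ?_
  simp [mmul, omul_add_left, Finset.sum_add_distrib]

lemma mmul_add_right (A B C : Matrix (Fin 3) (Fin 3) Oct) :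
    mmul A (B + C) = mmul A B + mmul A C := by
  refine Matrix.ext fun i j => ?_
  simp [mmul, omul_add_right, Finset.sum_add_distrib]

lemma mmul_smul_left (r : ℝ) (A B : Matrix (Fin 3) (Fin 3) Oct) :
    mmul (r • A) B = r • mmul A B := by
  refine Matrix.ext fun i j => ?_
  simp [mmul, omul_smul_left, Finset.smul_sum]

lemma mmul_smul_right (r : ℝ) (A B : Matrix (Fin 3) (Fin 3) Oct) :
    mmul A (r • B) = r • mmul A B := by
  refine Matrix.ext fun i j => ?_
  simp [mmul, omul_smul_right, Finset.smul_sum]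

lemma mmul_zero_left (B : Matrix (Fin 3) (Fin 3) Oct) : mmul 0 B = 0 := by
  refine Matrix.ext fun i j => ?_
  simp [mmul, omul_zero_left]

lemma mmul_zero_right (A : Matrix (Fin 3) (Fin 3) Oct) : mmul A 0 = 0 := by
  refine Matrix.ext fun i j => ?_
  simp [mmul, omul_zero_right]

/-- The 27-dimensional real vector space of 3×3 octonionic Hermitian matrices. -/
def hermSubmodule : Submodule ℝ (Matrix (Fin 3) (Fin 3) Oct) where
  carrier := {A | octConjT A = A}
  zero_mem' := by
    show octConjT 0 = 0
    refine Matrix.ext fun i j => ?_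
    simp [octConjT, oconj, Prod.ext_iff]
  add_mem' := by
    intro A B hA hB
    show octConjT (A + B) = A + B
    rw [octConjT_add]
    rw [Set.mem_setOf_eq] at hA hB
    rw [hA, hB]
  smul_mem' := by
    intro r A hA
    show octConjT (r • A) = r • A
    rw [octConjT_smul]
    rw [Set.mem_setOf_eq] at hA
    rw [hA]

lemma mem_hermSubmodule {A : Matrix (Fin 3) (Fin 3) Oct} :
    A ∈ hermSubmodule ↔ octConjT A = A := Iff.rfl

/-- The Albert algebra `H₃(𝕆)` as a type: 3×3 octonionic Hermitian matrices. -/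
def H3 : Type := ↥hermSubmodule

instance : AddCommGroup H3 := Submodule.addCommGroup hermSubmodule
instance : Module ℝ H3 := Submodule.module hermSubmodule

/-- The underlying octonionic matrix of an element of `H₃(𝕆)`. -/
def H3.mat (X : H3) : Matrix (Fin 3) (Fin 3) Oct := Subtype.val X

lemma H3.isHerm (X : H3) : octConjT X.mat = X.mat := X.2

/-- The Jordan product X∘Y = (1/2)(XY + YX) on `H₃(𝕆)`. -/
def jmul (X Y : H3) : H3 :=
  ⟨(1/2 : ℝ) • (mmul X.mat Y.mat + mmul Y.mat X.mat), by
    have hX : octConjT X.mat = X.mat := X.isHerm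
    have hY : octConjT Y.mat = Y.mat := Y.isHerm
    rw [mem_hermSubmodule, octConjT_smul, octConjT_add, octConjT_mmul, octConjT_mmul,
      hX, hY, add_comm]⟩

/-- The trace of an element of `H₃(𝕆)` (the sum of its real diagonal entries). -/
def htrace (X : H3) : ℝ := (X.mat 0 0).1.re + (X.mat 1 1).1.re + (X.mat 2 2).1.re

lemma omul_oone (x : Oct) : omul x oone = x := by
  simp [omul, oone]

lemma oone_omul (x : Oct) : omul oone x = x := by
  simp [omul, oone]

lemma re_omul_comm (x y : Oct) : (omul x y).1.re = (omul y x).1.re := by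
  simp [omul]
  ring

lemma re_omul_assoc (x y z : Oct) :
    (omul (omul x y) z).1.re = (omul x (omul y z)).1.re := by
  simp [omul]
  ring

/-- The real part of the sum of the diagonal entries of an octonionic matrix. -/
def reTrace (A : Matrix (Fin 3) (Fin 3) Oct) : ℝ := ∑ i, (A i i).1.re

lemma reTrace_add (A B : Matrix (Fin 3) (Fin 3) Oct) :
    reTrace (A + B) = reTrace A + reTrace B := by
  simp [reTrace, Finset.sum_add_distrib]

lemma reTrace_smul (r : ℝ) (A : Matrix (Fin 3) (Fin 3) Oct) :
    reTrace (r • A) = r * reTrace A := by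
  simp [reTrace, Finset.mul_sum]

lemma reTrace_mmul_comm (A B : Matrix (Fin 3) (Fin 3) Oct) :
    reTrace (mmul A B) = reTrace (mmul B A) := by
  simp only [reTrace, mmul, Matrix.of_apply, Fin.sum_univ_three, Prod.fst_add,
    Quaternion.re_add, re_omul_comm (A _ _)]
  ring

lemma reTrace_mmul_assoc (A B C : Matrix (Fin 3) (Fin 3) Oct) :
    reTrace (mmul (mmul A B) C) = reTrace (mmul A (mmul B C)) := by
  simp only [reTrace, mmul, Matrix.of_apply, Fin.sum_univ_three, Prod.fst_add,
    Quaternion.re_add, omul_add_left, omul_add_right, re_omul_assoc]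
  ring

lemma htrace_eq_reTrace (X : H3) : htrace X = reTrace X.mat := by
  simp [htrace, reTrace, Fin.sum_univ_three]

lemma H3.ext_mat {X Y : H3} (h : ∀ i j, X.mat i j = Y.mat i j) : X = Y :=
  Subtype.ext (Matrix.ext h)

@[simp] lemma H3.mat_add (X Y : H3) : (X + Y).mat = X.mat + Y.mat := rfl

@[simp] lemma H3.mat_sub (X Y : H3) : (X - Y).mat = X.mat - Y.mat := rfl

@[simp] lemma H3.mat_smul (r : ℝ) (X : H3) : (r • X).mat = r • X.mat := rfl

lemma jmul_mat (X Y : H3) :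
    (jmul X Y).mat = (1/2 : ℝ) • (mmul X.mat Y.mat + mmul Y.mat X.mat) := rfl

lemma jmul_comm (X Y : H3) : jmul X Y = jmul Y X :=
  H3.ext_mat fun i j => by rw [jmul_mat, jmul_mat, add_comm]

lemma jmul_add_left (X Y Z : H3) : jmul (X + Y) Z = jmul X Z + jmul Y Z :=
  H3.ext_mat fun i j => by
    simp only [jmul_mat, H3.mat_add, mmul_add_left, mmul_add_right, Matrix.smul_apply,
      Matrix.add_apply]
    module

lemma jmul_smul_left (r : ℝ) (X Y : H3) : jmul (r • X) Y = r • jmul X Y :=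
  H3.ext_mat fun i j => by
    simp only [jmul_mat, H3.mat_smul, mmul_smul_left, mmul_smul_right, Matrix.smul_apply,
      Matrix.add_apply]
    module

/-- The trace of `H₃(𝕆)` is associative for the Jordan product. -/
lemma htrace_jmul_assoc (X Y Z : H3) :
    htrace (jmul (jmul X Y) Z) = htrace (jmul X (jmul Y Z)) := by
  have h : reTrace (mmul (mmul Y.mat X.mat) Z.mat) = reTrace (mmul X.mat (mmul Z.mat Y.mat)) := by
    rw [reTrace_mmul_comm, ← reTrace_mmul_assoc, reTrace_mmul_comm]
  simp only [htrace_eq_reTrace, jmul_mat, mmul_smul_left, mmul_smul_right, mmul_add_left,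
    mmul_add_right, reTrace_smul, reTrace_add, reTrace_mmul_comm Z.mat (mmul _ _),
    reTrace_mmul_comm (mmul _ _) X.mat, h, reTrace_mmul_assoc X.mat Y.mat Z.mat]

/-- The trace of `H₃(𝕆)` as a linear functional. -/
def htraceLin : H3 →ₗ[ℝ] ℝ where
  toFun := htrace
  map_add' X Y := by simp [htrace_eq_reTrace, reTrace_add]
  map_smul' r X := by simp [htrace_eq_reTrace, reTrace_smul]

/-- The diagonal idempotent with a single `1` in position `(i, i)`. -/
def diagIdem (i : Fin 3) : H3 :=
  ⟨Matrix.of fun a b => if a = i ∧ b = i then oone else 0, by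
    refine Matrix.ext fun a b => ?_
    simp only [octConjT, Matrix.of_apply, and_comm (a := b = i)]
    split_ifs <;> simp [oconj, oone, Prod.ext_iff]⟩

/-- The Hermitian matrix with a `1` in positions `(i, j)` and `(j, i)`, and `0` elsewhere. -/
def swapElt (i j : Fin 3) : H3 :=
  ⟨Matrix.of fun a b => if (a = i ∧ b = j) ∨ (a = j ∧ b = i) then oone else 0, by
    refine Matrix.ext fun a b => ?_
    simp only [octConjT, Matrix.of_apply, and_comm (a := b = _), or_comm (a := a = j ∧ b = i)]
    split_ifs <;> simp [oconj, oone, Prod.ext_iff]⟩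

lemma diagIdem_mat (i a b : Fin 3) :
    (diagIdem i).mat a b = if a = i ∧ b = i then oone else 0 := rfl

lemma swapElt_mat (i j a b : Fin 3) :
    (swapElt i j).mat a b = if (a = i ∧ b = j) ∨ (a = j ∧ b = i) then oone else 0 := rfl

/-- Entries of the Jordan product with a diagonal idempotent. -/
lemma jmul_diagIdem_mat (i a b : Fin 3) (X : H3) :
    (jmul (diagIdem i) X).mat a b =
      (1/2 : ℝ) • ((if a = i then X.mat a b else 0) + (if b = i then X.mat a b else 0)) := by
  simp only [jmul_mat, Matrix.smul_apply, Matrix.add_apply, mmul, Matrix.of_apply,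
    diagIdem_mat, Fin.sum_univ_three]
  fin_cases i <;> fin_cases a <;> fin_cases b <;>
    simp [omul_zero_left, omul_zero_right, omul_oone, oone_omul]

lemma jmul_diagIdem_self (i : Fin 3) : jmul (diagIdem i) (diagIdem i) = diagIdem i := by
  refine H3.ext_mat fun a b => ?_
  rw [jmul_diagIdem_mat, diagIdem_mat]
  by_cases ha : a = i <;> by_cases hb : b = i <;> simp [ha, hb, ← two_smul ℝ oone, smul_smul]

lemma jmul_diagIdem_add {i j : Fin 3} (hij : i ≠ j) :
    jmul (diagIdem i) (diagIdem i + diagIdem j) = diagIdem i := by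
  refine H3.ext_mat fun a b => ?_
  rw [jmul_diagIdem_mat, H3.mat_add, Matrix.add_apply, diagIdem_mat, diagIdem_mat]
  by_cases ha : a = i <;> by_cases hb : b = i <;>
    simp [ha, hb, hij, ← two_smul ℝ oone, smul_smul]

lemma jmul_diagIdem_swapElt {i j : Fin 3} (hij : i ≠ j) :
    jmul (diagIdem i) (swapElt i j) = (1/2 : ℝ) • swapElt i j := by
  refine H3.ext_mat fun a b => ?_
  rw [jmul_diagIdem_mat, H3.mat_smul, Matrix.smul_apply, swapElt_mat]
  by_cases ha : a = i <;> by_cases hb : b = i <;> simp [ha, hb, hij]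

lemma jmul_swapElt_self {i j : Fin 3} (hij : i ≠ j) :
    jmul (swapElt i j) (swapElt i j) = diagIdem i + diagIdem j := by
  refine H3.ext_mat fun a b => ?_
  simp only [jmul_mat, Matrix.smul_apply, Matrix.add_apply, mmul, Matrix.of_apply, H3.mat_add,
    diagIdem_mat, swapElt_mat, Fin.sum_univ_three]
  fin_cases i <;> fin_cases j <;> first | exact absurd rfl hij | skip
  all_goals
    fin_cases a <;> fin_cases b <;>
      simp [omul_zero_right, omul_oone, ← two_smul ℝ oone, smul_smul]

/-- The unit of the Albert algebra. -/
def hone : H3 := ∑ i, diagIdem i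

lemma jmul_hone_left (X : H3) : jmul hone X = X := by
  refine H3.ext_mat fun a b => ?_
  simp only [hone, Fin.sum_univ_three, jmul_add_left, H3.mat_add, Matrix.add_apply,
    jmul_diagIdem_mat]
  fin_cases a <;> fin_cases b <;> simp <;> module

lemma diag_entry_eq (X : H3) (i : Fin 3) : X.mat i i = (X.mat i i).1.re • oone := by
  have h : oconj (X.mat i i) = X.mat i i := congrFun (congrFun X.isHerm i) i
  simp only [oconj, Prod.ext_iff, Quaternion.ext_iff] at h
  simp only [oone, Prod.ext_iff, Quaternion.ext_iff]
  simp at h ⊢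
  refine ⟨⟨?_, ?_, ?_⟩, ?_, ?_, ?_, ?_⟩ <;> linarith [h.1, h.2]

/-- Every element is a diagonal matrix plus a sum of associators. -/
lemma eq_diag_add_associators (X : H3) :
    X = ∑ i, ((X.mat i i).1.re • diagIdem i +
      (2 : ℝ) • (jmul (diagIdem i) X - jmul (diagIdem i) (jmul (diagIdem i) X))) := by
  refine H3.ext_mat fun a b => ?_
  simp only [Fin.sum_univ_three, H3.mat_add, H3.mat_sub, H3.mat_smul, Matrix.add_apply,
    Matrix.sub_apply, Matrix.smul_apply, jmul_diagIdem_mat, diagIdem_mat]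
  by_cases hab : a = b
  · subst hab
    rw [diag_entry_eq X a]
    fin_cases a <;> simp <;> module
  · fin_cases a <;> fin_cases b <;> first | exact absurd rfl hab | skip
    all_goals
      simp
      module

/-- An associative linear functional on the Albert algebra is a multiple of the trace. -/
lemma three_mul_eq_of_assoc (t : H3 →ₗ[ℝ] ℝ)
    (ht : ∀ X Y Z, t (jmul (jmul X Y) Z) = t (jmul X (jmul Y Z))) (X : H3) :
    3 * t X = t hone * htrace X := by
  have hdiag : ∀ {i j : Fin 3}, i ≠ j → t (diagIdem i) = t (diagIdem j) := by
    intro i j hij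
    have h := ht (diagIdem i) (swapElt i j) (swapElt i j)
    rw [jmul_diagIdem_swapElt hij, jmul_smul_left, jmul_swapElt_self hij,
      jmul_diagIdem_add hij, map_smul, map_add, smul_eq_mul] at h
    linarith
  have hX : t X = ∑ i, (X.mat i i).1.re * t (diagIdem i) := by
    conv_lhs => rw [eq_diag_add_associators X]
    simp only [map_sum, map_add, map_smul, map_sub, ← ht, jmul_diagIdem_self, sub_self,
      smul_eq_mul, mul_zero, add_zero]
  rw [hX, hone, htrace, map_sum]
  simp only [Fin.sum_univ_three, ← hdiag (i := 0) (j := 1) (by decide),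
    ← hdiag (i := 0) (j := 2) (by decide)]
  ring

/-- any linear automorphism of the Albert algebra preserves the trace. -/
theorem automorphism_preserves_trace (φ : H3 →ₗ[ℝ] H3) (hbij : Function.Bijective φ)
    (hhom : ∀ X Y : H3, φ (jmul X Y) = jmul (φ X) (φ Y)) :
    ∀ X : H3, htrace (φ X) = htrace X := by
  intro X
  have hone_map : φ hone = hone := by
    obtain ⟨U, hU⟩ := hbij.surjective hone
    calc φ hone = jmul hone (φ hone) := (jmul_hone_left _).symm
      _ = φ (jmul hone U) := by rw [hhom, hU, jmul_comm]
      _ = hone := by rw [jmul_hone_left, hU]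
  have hassoc : ∀ X Y Z, (htraceLin ∘ₗ φ) (jmul (jmul X Y) Z) =
      (htraceLin ∘ₗ φ) (jmul X (jmul Y Z)) := fun X Y Z => by
    simp only [LinearMap.comp_apply, hhom]
    exact htrace_jmul_assoc _ _ _
  have h := three_mul_eq_of_assoc (htraceLin ∘ₗ φ) hassoc X
  have h1 : (htraceLin ∘ₗ φ) hone = 3 := by
    rw [LinearMap.comp_apply, hone_map]
    change htrace hone = 3
    simp [hone, htrace, Fin.sum_univ_three, diagIdem_mat, oone]
    norm_num
  rw [h1] at h
  exact mul_left_cancel₀ three_ne_zero h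
end
end

section
/- The Okubo algebra is a symmetric composition algebra: x*(y*x) = n(x)·y and (x*y)*x = n(x)·y for all x, y ∈ 𝒪. -/
/- The real Okubo algebra: traceless Hermitian 3×3 complex matrices with the
Okubo product x*y = μ·(xy) + conj(μ)·(yx) − (1/3)·Tr(xy)·I, μ = (3 + i√3)/6. -/

noncomputable section

open Matrix

/-- 3×3 complex matrices. -/
abbrev OkM : Type := Matrix (Fin 3) (Fin 3) ℂ

/-- The parameter μ = (3 + i√3)/6. -/
def okMu : ℂ := (3 + (Real.sqrt 3 : ℝ) * Complex.I) / 6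

/-- Membership in the Okubo algebra: Hermitian and traceless. -/
def IsOkubo (x : OkM) : Prop := x.IsHermitian ∧ x.trace = 0

/-- The Okubo product x*y = μ·(xy) + conj(μ)·(yx) − (1/3)·Tr(xy)·I. -/
def okmul (x y : OkM) : OkM :=
  okMu • (x * y) + (starRingEnd ℂ) okMu • (y * x) - ((1 / 3 : ℂ) * (x * y).trace) • (1 : OkM)

/-- The Okubo norm n(x) = (1/6)·Tr(x²). -/
def oknorm (x : OkM) : ℝ := ((1 / 6 : ℂ) * (x * x).trace).re

/-- The polarized Cayley–Hamilton identity for traceless 3×3 matrices. -/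
theorem polarized_cayley_hamilton_of_trace_eq_zero {R : Type*} [CommRing R]
    (x y : Matrix (Fin 3) (Fin 3) R) (hx : x.trace = 0) (hy : y.trace = 0) :
    (2 : R) • (x * y * x + x * x * y + y * x * x) =
      (2 * (x * y).trace) • x + (x * x).trace • y + (2 * (x * x * y).trace) • 1 := by
  have hx' : x 2 2 = -x 0 0 - x 1 1 := by
    rw [Matrix.trace_fin_three] at hx
    linear_combination hx
  have hy' : y 2 2 = -y 0 0 - y 1 1 := by
    rw [Matrix.trace_fin_three] at hy
    linear_combination hy
  ext i j
  fin_cases i <;> fin_cases j <;>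
    simp [Matrix.mul_apply, Fin.sum_univ_three, Matrix.trace_fin_three, hx', hy'] <;> ring

theorem okMu_mul_conj : okMu * (starRingEnd ℂ) okMu = 1 / 3 := by
  have h : ((Real.sqrt 3 : ℝ) : ℂ) ^ 2 = 3 := by
    rw [← Complex.ofReal_pow, Real.sq_sqrt (by norm_num)]
    norm_num
  simp only [okMu, map_div₀, map_add, map_mul, Complex.conj_ofReal, Complex.conj_I, map_ofNat]
  linear_combination (-Complex.I ^ 2 / 36) * h - (1 / 12) * Complex.I_sq

theorem okMu_add_conj : okMu + (starRingEnd ℂ) okMu = 1 := by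
  simp only [okMu, map_div₀, map_add, map_mul, Complex.conj_ofReal, Complex.conj_I, map_ofNat]
  ring

theorem ofReal_oknorm {x : OkM} (hx : x.IsHermitian) :
    (oknorm x : ℂ) = 1 / 6 * (x * x).trace := by
  refine Complex.conj_eq_iff_re.mp ?_
  have h : star (x * x).trace = (x * x).trace := by
    rw [← Matrix.trace_conjTranspose, Matrix.conjTranspose_mul, hx.eq]
  rw [map_mul, starRingEnd_apply (x * x).trace, h, map_div₀, map_one, map_ofNat]

theorem trace_okmul_mul (x y : OkM) (hx : x.trace = 0) :
    (okmul x y * x).trace = (x * x * y).trace := by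
  simp only [okmul, sub_mul, add_mul, smul_mul_assoc, one_mul, Matrix.trace_sub,
    Matrix.trace_add, Matrix.trace_smul, hx, smul_eq_mul]
  rw [Matrix.trace_mul_cycle y x x, Matrix.trace_mul_cycle x y x]
  linear_combination (x * x * y).trace * okMu_add_conj

theorem trace_mul_okmul (x y : OkM) (hx : x.trace = 0) :
    (x * okmul y x).trace = (x * x * y).trace := by
  simp only [okmul, mul_sub, mul_add, mul_smul_comm, mul_one, Matrix.trace_sub,
    Matrix.trace_add, Matrix.trace_smul, hx, smul_eq_mul, ← mul_assoc]
  rw [Matrix.trace_mul_cycle x y x]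
  linear_combination (x * x * y).trace * okMu_add_conj

/-- STATEMENT 13: the Okubo algebra is a symmetric composition algebra:
x*(y*x) = n(x)·y = (x*y)*x. -/
theorem okubo_symmetric_composition (x y : OkM) (hx : IsOkubo x) (hy : IsOkubo y) :
    okmul x (okmul y x) = oknorm x • y ∧ okmul (okmul x y) x = oknorm x • y := by
  have hCH := polarized_cayley_hamilton_of_trace_eq_zero x y hx.2 hy.2
  have hn : oknorm x • y = (1 / 6 * (x * x).trace) • y := by
    rw [← ofReal_oknorm hx.1, Complex.coe_smul]
  have hm := okMu_mul_conj
  have ha := okMu_add_conj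
  have hc : (starRingEnd ℂ) okMu = 1 - okMu := by linear_combination ha
  rw [hc] at hm
  constructor
  · rw [hn, okmul, trace_mul_okmul x y hx.2, okmul, Matrix.trace_mul_comm y x, hc]
    simp only [mul_sub, mul_add, sub_mul, add_mul, mul_smul_comm, smul_mul_assoc, mul_one,
      one_mul, ← mul_assoc]
    linear_combination (norm := module) (1 / 6 : ℂ) • hCH +
      hm • (x * x * y + y * x * x - (2 : ℂ) • (x * y * x))
  · rw [hn, okmul, trace_okmul_mul x y hx.2, okmul, hc]
    simp only [mul_sub, mul_add, sub_mul, add_mul, mul_smul_comm, smul_mul_assoc, mul_one,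
      one_mul, ← mul_assoc]
    linear_combination (norm := module) (1 / 6 : ℂ) • hCH +
      hm • (x * x * y + y * x * x - (2 : ℂ) • (x * y * x))
end
end

section
/- Let e = diag(2,−1,−1) ∈ 𝒪 and define τ : 𝒪 → 𝒪 by τ(x) = (((x*e)*e)*e)*e. Then τ is an order-three automorphism of the Okubo algebra: τ(x*y) = τ(x)*τ(y) for all x, y ∈ 𝒪, and τ∘τ∘τ = id. -/
/- The real Okubo algebra: traceless Hermitian 3×3 complex matrices with the
Okubo product x*y = μ·(xy) + conj(μ)·(yx) − (1/3)·Tr(xy)·I, μ = (3 + i√3)/6. -/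

noncomputable section

open Matrix

/-- The idempotent e = diag(2,−1,−1) of the Okubo algebra. -/
def okE : OkM := Matrix.diagonal ![2, -1, -1]

/-- The derived (octonionic) product x·y = (e*x)*(y*e). -/
def okDmul (x y : OkM) : OkM := okmul (okmul okE x) (okmul y okE)

/-- The conjugation conj(x) = ((x*e)*e)*e. -/
def okConj (x : OkM) : OkM := okmul (okmul (okmul x okE) okE) okE

/-- The order-three automorphism τ(x) = (((x*e)*e)*e)*e. -/
def okTau (x : OkM) : OkM := okmul (okmul (okmul (okmul x okE) okE) okE) okE

lemma conj_okMu : (starRingEnd ℂ) okMu = 1 - okMu := by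
  simp only [okMu, map_div₀, map_add, map_mul, map_ofNat, Complex.conj_ofReal, Complex.conj_I]
  ring

lemma okMu_sq : okMu ^ 2 = okMu - 1 / 3 := by
  have h : ((Real.sqrt 3 : ℝ) : ℂ) ^ 2 = 3 := by
    exact_mod_cast congrArg ((↑) : ℝ → ℂ) (Real.sq_sqrt (show (0 : ℝ) ≤ 3 by norm_num))
  unfold okMu
  linear_combination (Complex.I ^ 2 / 36) * h + (1 / 12) * Complex.I_sq

lemma trace_okmul (x y : OkM) : (okmul x y).trace = 0 := by
  simp only [okmul, trace_sub, trace_add, trace_smul, trace_one, Matrix.trace_mul_comm y x,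
    conj_okMu, smul_eq_mul, Fintype.card_fin]
  push_cast
  ring

/-- The Okubo product commutes with conjugation by an invertible matrix. -/
lemma okmul_conj {p q : OkM} (hpq : p * q = 1) (x y : OkM) :
    okmul (p * x * q) (p * y * q) = p * okmul x y * q := by
  have hqp : q * p = 1 := mul_eq_one_comm.mp hpq
  have key (a b : OkM) : p * a * q * (p * b * q) = p * (a * b) * q := by
    calc p * a * q * (p * b * q) = p * a * (q * p) * b * q := by simp only [mul_assoc]
      _ = p * (a * b) * q := by rw [hqp, mul_one]; simp only [mul_assoc]
  have htr : (p * (x * y) * q).trace = (x * y).trace := by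
    rw [Matrix.trace_mul_comm, ← mul_assoc, hqp, one_mul]
  simp only [okmul, key, htr, mul_sub, mul_add, sub_mul, add_mul, Matrix.mul_smul,
    Matrix.smul_mul, mul_one, hpq]

/-- The primitive cube root of unity `3μ - 2 = (-1 + i√3) / 2`. -/
def okOmega : ℂ := 3 * okMu - 2

lemma okOmega_sq : okOmega ^ 2 = 1 - 3 * okMu := by
  unfold okOmega
  linear_combination 9 * okMu_sq

lemma okOmega_cube : okOmega ^ 3 = 1 := by
  have h := okOmega_sq
  unfold okOmega at *
  linear_combination (3 * okMu - 2) * h - 9 * okMu_sq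

/-- The matrix `diag(ω, 1, 1)`. -/
def okD : OkM := Matrix.diagonal ![okOmega, 1, 1]

lemma okD_cube : okD ^ 3 = 1 := by
  rw [okD, Matrix.diagonal_pow, ← Matrix.diagonal_one]
  congr 1
  ext i
  fin_cases i <;> simp [okOmega_cube]

lemma okD_mul_sq : okD * okD ^ 2 = 1 := by
  rw [← pow_succ', okD_cube]

lemma okmul_okE {x : OkM} (hx : x.trace = 0) :
    okmul x okE = !![x 0 0, -okOmega * x 0 1, -okOmega * x 0 2;
      -okOmega ^ 2 * x 1 0, x 2 2, -x 1 2;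
      -okOmega ^ 2 * x 2 0, -x 2 1, x 1 1] := by
  rw [Matrix.trace_fin_three] at hx
  rw [okOmega_sq, okOmega]
  ext i j
  fin_cases i <;> fin_cases j <;>
    simp [okmul, okE, conj_okMu, Matrix.trace_fin_three] <;> grind

/-- On traceless matrices, `τ` is conjugation by `diag(ω, 1, 1)`. -/
lemma okTau_eq_conj {x : OkM} (hx : x.trace = 0) : okTau x = okD * x * okD ^ 2 := by
  rw [okTau, okmul_okE (trace_okmul _ _), okmul_okE (trace_okmul _ _),
    okmul_okE (trace_okmul _ _), okmul_okE hx, okD, Matrix.diagonal_pow]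
  have h := okOmega_cube
  ext i j
  fin_cases i <;> fin_cases j <;> simp <;> grind

/-- STATEMENT 16: τ(x) = (((x*e)*e)*e)*e is an order-three automorphism of the
Okubo algebra. -/
theorem okubo_tau_automorphism :
    (∀ x y : OkM, IsOkubo x → IsOkubo y → okTau (okmul x y) = okmul (okTau x) (okTau y)) ∧
    (∀ x : OkM, IsOkubo x → okTau (okTau (okTau x)) = x) := by
  refine ⟨fun x y hx hy => ?_, fun x hx => ?_⟩
  · rw [okTau_eq_conj hx.2, okTau_eq_conj hy.2, okTau_eq_conj (trace_okmul x y),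
      okmul_conj okD_mul_sq]
  · have htr (y : OkM) : (okTau y).trace = 0 := trace_okmul _ _
    rw [okTau_eq_conj (htr _), okTau_eq_conj (htr _), okTau_eq_conj hx.2]
    calc okD * (okD * (okD * x * okD ^ 2) * okD ^ 2) * okD ^ 2
        = okD ^ 3 * x * (okD ^ 3) ^ 2 := by noncomm_ring
      _ = x := by rw [okD_cube, one_pow, one_mul, mul_one]
end
end
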